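/- For every n ≥ 2 and every ε > 0, there exists a full-dimensional closed convex set P ⊆ ℝⁿ (a translated polyhedral cone) whose integer hull conv(P ∩ ℤⁿ) is nonempty and satisfies depth_P(conv(P ∩ ℤⁿ)) > √(3 + n)/2 − ε. -/

import Mathlib

open Metric Set
open scoped ENNReal InnerProductSpace

/-- The depth of a point `x` with respect to `P`:
`sup { r ≥ 0 : B(x,r) ∩ aff(P) ⊆ P }` (valued in `ℝ≥0∞`). -/
noncomputable def ptDepth {ι : Type*} [Fintype ι]
    (P : Set (EuclideanSpace ℝ ι)) (x : EuclideanSpace ℝ ι) : ℝ≥0∞ :=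
  ⨆ r ∈ {r : ℝ | 0 ≤ r ∧
      Metric.closedBall x r ∩ (affineSpan ℝ P : Set (EuclideanSpace ℝ ι)) ⊆ P},
    ENNReal.ofReal r

/-- The depth of a subset `S ⊆ P` with respect to `P`:
`sup { depth_P(x) : x ∈ P \ S }` (sup of the empty set is `0`). -/
noncomputable def setDepth {ι : Type*} [Fintype ι]
    (P S : Set (EuclideanSpace ℝ ι)) : ℝ≥0∞ :=
  ⨆ x ∈ P \ S, ptDepth P x


/-- The set of integer points of `ℝⁿ`. -/
def intPts (n : ℕ) : Set (EuclideanSpace ℝ (Fin n)) :=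
  {x | ∀ i, ∃ m : ℤ, x i = m}


/-- The point `(1/2, …, 1/2, 1 - δ)`. -/
noncomputable def cubeAxisPoint (m : ℕ) (δ : ℝ) : EuclideanSpace ℝ (Fin (m + 1)) :=
  WithLp.toLp 2 (Fin.snoc (fun _ => 1 / 2) (1 - δ))

theorem dist_cubeAxisPoint_sq (m : ℕ) (δ : ℝ) (y : EuclideanSpace ℝ (Fin (m + 1))) :
    dist y (cubeAxisPoint m δ) ^ 2 =
      ∑ i : Fin m, (y i.castSucc - 1 / 2) ^ 2 + (y (Fin.last m) - (1 - δ)) ^ 2 := by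
  rw [EuclideanSpace.dist_eq, Real.sq_sqrt (Finset.sum_nonneg fun _ _ => sq_nonneg _),
    Fin.sum_univ_castSucc]
  simp only [cubeAxisPoint, Fin.snoc_castSucc, Fin.snoc_last, Real.dist_eq, sq_abs]

theorem quarter_le_sq_intCast_sub_half (k : ℤ) : 1 / 4 ≤ ((k : ℝ) - 1 / 2) ^ 2 := by
  rcases le_or_gt k 0 with h | h
  · have : (k : ℝ) ≤ 0 := by exact_mod_cast h
    nlinarith
  · have : (1 : ℝ) ≤ k := by exact_mod_cast h
    nlinarith

/-- An integer point whose last coordinate is not positive is at squared distance at least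
`m / 4 + (1 - δ) ^ 2` from `cubeAxisPoint m δ`. -/
theorem one_le_last_of_dist_sq_lt {m : ℕ} {δ : ℝ} (hδ : δ ≤ 1)
    {y : EuclideanSpace ℝ (Fin (m + 1))} (hy : y ∈ intPts (m + 1))
    (h : dist y (cubeAxisPoint m δ) ^ 2 < m / 4 + (1 - δ) ^ 2) : 1 ≤ y (Fin.last m) := by
  obtain ⟨k, hk⟩ := hy (Fin.last m)
  rw [hk]
  by_contra! hlt
  replace hlt : (k : ℝ) < 1 := hlt
  have hk0 : (k : ℝ) ≤ 0 := by
    have : k < 1 := by exact_mod_cast hlt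
    exact_mod_cast Int.lt_add_one_iff.mp this
  have hsum : (m : ℝ) / 4 ≤ ∑ i : Fin m, (y i.castSucc - 1 / 2) ^ 2 := by
    calc (m : ℝ) / 4 = ∑ _i : Fin m, (1 / 4 : ℝ) := by simp [div_eq_mul_inv]
      _ ≤ _ := Finset.sum_le_sum fun i _ => by
        obtain ⟨l, hl⟩ := hy i.castSucc
        rw [hl]
        exact quarter_le_sq_intCast_sub_half l
  rw [dist_cubeAxisPoint_sq, hk] at h
  nlinarith

theorem cubeAxisPoint_notMem_convexHull {m : ℕ} {δ r : ℝ} (hδ : 0 < δ) (hδ1 : δ ≤ 1)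
    (hr : r ^ 2 < m / 4 + (1 - δ) ^ 2) :
    cubeAxisPoint m δ ∉ convexHull ℝ (closedBall (cubeAxisPoint m δ) r ∩ intPts (m + 1)) := by
  intro hx
  have hsub : closedBall (cubeAxisPoint m δ) r ∩ intPts (m + 1) ⊆
      {y | 1 ≤ EuclideanSpace.proj (𝕜 := ℝ) (Fin.last m) y} := by
    rintro y ⟨hyr, hy⟩
    exact one_le_last_of_dist_sq_lt hδ1 hy
      ((pow_le_pow_left₀ dist_nonneg (mem_closedBall.mp hyr) 2).trans_lt hr)
  have hconv : Convex ℝ {y : EuclideanSpace ℝ (Fin (m + 1)) |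
      1 ≤ EuclideanSpace.proj (𝕜 := ℝ) (Fin.last m) y} :=
    convex_halfSpace_ge (LinearMap.isLinear (EuclideanSpace.proj (Fin.last m)).toLinearMap) 1
  have h := convexHull_min hsub hconv hx
  simp [cubeAxisPoint] at h
  linarith

theorem closedBall_cubeAxisPoint_inter_intPts_nonempty {m : ℕ} {δ r : ℝ} (hr0 : 0 ≤ r)
    (hr : m / 4 + δ ^ 2 ≤ r ^ 2) :
    (closedBall (cubeAxisPoint m δ) r ∩ intPts (m + 1)).Nonempty := by
  refine ⟨WithLp.toLp 2 fun _ => 1, ?_, fun _ => ⟨1, by simp⟩⟩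
  rw [mem_closedBall]
  refine abs_le_of_sq_le_sq' ?_ hr0 |>.2
  rw [dist_cubeAxisPoint_sq]
  refine le_trans (le_of_eq ?_) hr
  simp
  ring

theorem ofReal_le_setDepth_closedBall {ι : Type*} [Fintype ι] {x : EuclideanSpace ℝ ι} {r : ℝ}
    (hr : 0 ≤ r) {S : Set (EuclideanSpace ℝ ι)} (hx : x ∉ S) :
    ENNReal.ofReal r ≤ setDepth (closedBall x r) S := by
  have h : ENNReal.ofReal r ≤ ptDepth (closedBall x r) x :=
    le_iSup₂_of_le (f := fun (r : ℝ) _ => ENNReal.ofReal r) r ⟨hr, inter_subset_left⟩ le_rfl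
  exact h.trans (le_iSup₂_of_le x ⟨mem_closedBall_self hr, hx⟩ le_rfl)

/-- For every `n ≥ 2` and `ε > 0` there exists a full-dimensional closed
convex set `P ⊆ ℝⁿ` with nonempty integer hull such that
`depth_P(conv(P ∩ ℤⁿ)) > √(3 + n)/2 − ε`. -/
theorem exists_deep_integerHull {n : ℕ} (hn : 2 ≤ n) (ε : ℝ) (hε : 0 < ε) :
    ∃ P : Set (EuclideanSpace ℝ (Fin n)),
      Convex ℝ P ∧ IsClosed P ∧ affineSpan ℝ P = ⊤ ∧
      (convexHull ℝ (P ∩ intPts n)).Nonempty ∧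
      ENNReal.ofReal (Real.sqrt (3 + n) / 2 - ε)
        < setDepth P (convexHull ℝ (P ∩ intPts n)) := by
  obtain ⟨m, rfl⟩ : ∃ m, n = m + 1 := ⟨n - 1, by omega⟩
  set s : ℝ := √(3 + (m + 1 : ℕ)) / 2 with hs
  have hs2 : s ^ 2 = m / 4 + 1 := by
    rw [hs, div_pow, Real.sq_sqrt (by positivity)]
    push_cast
    ring
  have hs0 : 0 ≤ s := by positivity
  have hs1 : 1 ≤ s := by
    have : (0 : ℝ) ≤ m := m.cast_nonneg
    nlinarith
  obtain ⟨δ, hδ, hδε, hδs⟩ : ∃ δ : ℝ, 0 < δ ∧ 2 * δ < ε ∧ δ * s ≤ 1 / 8 := by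
    refine ⟨min (ε / 4) (1 / (8 * s)), by positivity, ?_, ?_⟩
    · linarith [min_le_left (ε / 4) (1 / (8 * s))]
    · calc _ ≤ 1 / (8 * s) * s := by gcongr; exact min_le_right _ _
        _ = 1 / 8 := by field_simp
  have hδ1 : δ ≤ 1 / 8 := by nlinarith
  set r : ℝ := s - 2 * δ with hr
  have hr0 : 0 < r := by linarith
  have hupper : r ^ 2 < m / 4 + (1 - δ) ^ 2 := by nlinarith
  have hlower : m / 4 + δ ^ 2 ≤ r ^ 2 := by nlinarith
  refine ⟨closedBall (cubeAxisPoint m δ) r, convex_closedBall _ _, isClosed_closedBall, ?_,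
    (closedBall_cubeAxisPoint_inter_intPts_nonempty hr0.le hlower).convexHull, ?_⟩
  · exact affineSpan_eq_top_of_nonempty_interior <|
      ⟨cubeAxisPoint m δ, interior_mono (subset_convexHull ℝ _)
        (ball_subset_interior_closedBall (mem_ball_self hr0))⟩
  · refine lt_of_lt_of_le ((ENNReal.ofReal_lt_ofReal_iff hr0).mpr (by linarith)) <|
      ofReal_le_setDepth_closedBall hr0.le
        (cubeAxisPoint_notMem_convexHull hδ (by linarith) hupper)
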